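/- arXiv:math/0401373 — 4 statements merged into one kernel-verified Lean document; each statement's English description precedes it below -/
import Mathlib

section
/- Let A and B be antichains in a finite lattice L. If A ≤ B in the domination order on antichains, then B* ≤ A*, where * denotes the blocker operation. -/
/-- An antichain in a bounded lattice: a nonempty set of pairwise incomparable
elements not containing `⊥`. -/
def IsLatticeAntichain {L : Type*} [Lattice L] [BoundedOrder L] (A : Set L) : Prop :=
  IsAntichain (· ≤ ·) A ∧ A.Nonempty ∧ (⊥ : L) ∉ A

/-- The blocker of a set `A`: the minimal elements of
`{x | a ⊓ x ≠ ⊥ for every a ∈ A}`. -/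
def latticeBlocker {L : Type*} [Lattice L] [BoundedOrder L] (A : Set L) : Set L :=
  {x | Minimal (fun y => ∀ a ∈ A, a ⊓ y ≠ ⊥) x}

/-- The domination order on antichains: `A ≤ B` iff every `b ∈ B` is above
some `a ∈ A`. -/
def Dominates {L : Type*} [Lattice L] (A B : Set L) : Prop :=
  ∀ b ∈ B, ∃ a ∈ A, a ≤ b

/-- If `A ≤ B` in the domination order on antichains of a finite lattice, then
`B* ≤ A*`, where `*` denotes the blocker operation. -/
theorem blocker_antitone {L : Type*} [Lattice L] [BoundedOrder L] [Fintype L]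
    (A B : Set L) (hA : IsLatticeAntichain A) (hB : IsLatticeAntichain B)
    (hAB : Dominates A B) :
    Dominates (latticeBlocker B) (latticeBlocker A) := by
  rintro x ⟨hx, -⟩
  have hxB : ∀ b ∈ B, b ⊓ x ≠ ⊥ := fun b hb => by
    obtain ⟨a, ha, hab⟩ := hAB b hb
    exact ne_bot_of_le_ne_bot (hx a ha) (inf_le_inf_right x hab)
  obtain ⟨y, hyx, hy⟩ := exists_minimal_le_of_wellFoundedLT
    (fun y => ∀ b ∈ B, b ⊓ y ≠ ⊥) x hxB
  exact ⟨y, hy, hyx⟩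
end

section
/- Let A be an antichain in a finite lattice L. Then A* = A***, i.e., the blocker of A equals the blocker of the blocker of the blocker of A (as sets of elements of L). -/
/-- On a finite lattice, meeting every element of the blocker of `A` is the same as meeting
every element that meets all of `A`. -/
theorem forall_mem_latticeBlocker_inf_ne_bot_iff {L : Type*} [Lattice L] [BoundedOrder L]
    [Finite L] (A : Set L) (y : L) :
    (∀ b ∈ latticeBlocker A, b ⊓ y ≠ ⊥) ↔ ∀ b, (∀ a ∈ A, a ⊓ b ≠ ⊥) → b ⊓ y ≠ ⊥ := by
  refine ⟨fun h b hb => ?_, fun h b hb => h b (Minimal.prop (Set.mem_ofPred.mp hb))⟩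
  obtain ⟨m, hmb, hm⟩ :=
    (Set.toFinite {x : L | ∀ a ∈ A, a ⊓ x ≠ ⊥}).exists_le_minimal hb
  exact ne_bot_of_le_ne_bot (h m hm) (inf_le_inf_right y hmb)

/-- Meeting every element of the double blocker of `A` is the same as meeting every element
of `A`. -/
theorem forall_mem_latticeBlocker_latticeBlocker_inf_ne_bot_iff {L : Type*} [Lattice L]
    [BoundedOrder L] [Finite L] (A : Set L) (y : L) :
    (∀ b ∈ latticeBlocker (latticeBlocker A), b ⊓ y ≠ ⊥) ↔ ∀ a ∈ A, a ⊓ y ≠ ⊥ := by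
  simp only [forall_mem_latticeBlocker_inf_ne_bot_iff]
  refine ⟨fun h a ha => h a fun b hb => ?_, fun h b hb => ?_⟩
  · rw [inf_comm]
    exact hb a ha
  · rw [inf_comm]
    exact hb y h

/-- For any antichain `A` in a finite lattice, `A* = A***`. -/
theorem blocker_triple {L : Type*} [Lattice L] [BoundedOrder L] [Fintype L]
    (A : Set L) (hA : IsLatticeAntichain A) :
    latticeBlocker A = latticeBlocker (latticeBlocker (latticeBlocker A)) := by
  rw [latticeBlocker.eq_1 (latticeBlocker (latticeBlocker A))]
  simp only [forall_mem_latticeBlocker_latticeBlocker_inf_ne_bot_iff]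
  rfl
end

section
/- Let A be a subspace arrangement embedded in a finite hyperplane arrangement H in V = k^n. Then the union of the subspaces of the blocker A* contains the intersection over all X ∈ A of the sets V_{H/X}; that is, ⋃_{Y ∈ A*} Y ⊇ ⋂_{X ∈ A} V_{H/X}. -/
variable {k : Type*} [Field k] {n : ℕ}

/-- The intersection lattice of a hyperplane arrangement `H` in `k^n`: all
linear subspaces that are intersections of subsets of `H` (the empty
intersection being the whole space). -/
def intersectionLattice (H : Finset (Submodule k (Fin n → k))) :
    Set (Submodule k (Fin n → k)) :=
  {X | ∃ T ⊆ (H : Set (Submodule k (Fin n → k))), X = sInf T}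

/-- `A` is a subspace arrangement embedded in the hyperplane arrangement `H`:
a finite nonempty set of elements of the intersection lattice of `H`, none
equal to the whole space, pairwise incomparable under inclusion. -/
def IsEmbeddedArrangement (H : Finset (Submodule k (Fin n → k)))
    (A : Set (Submodule k (Fin n → k))) : Prop :=
  A.Finite ∧ A.Nonempty ∧ A ⊆ intersectionLattice H ∧ (∀ a ∈ A, a ≠ ⊤) ∧
    IsAntichain (· ≤ ·) A

/-- The blocker of `A` with respect to `H`: the maximal elements under
inclusion of the set of `X` in the intersection lattice such that for every
`a ∈ A` there is a hyperplane of `H` containing both `a` and `X`. -/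
def arrBlocker (H : Finset (Submodule k (Fin n → k)))
    (A : Set (Submodule k (Fin n → k))) : Set (Submodule k (Fin n → k)) :=
  {X | Maximal (fun Y => Y ∈ intersectionLattice H ∧
         ∀ a ∈ A, ∃ h ∈ H, a ≤ h ∧ Y ≤ h) X}

/-- `V_{H/X}`: the union, as a set of vectors, of the hyperplanes of `H`
containing `X`. -/
def VHX (H : Finset (Submodule k (Fin n → k))) (X : Submodule k (Fin n → k)) :
    Set (Fin n → k) :=
  ⋃ h ∈ {h ∈ (H : Set (Submodule k (Fin n → k))) | X ≤ h}, (h : Set (Fin n → k))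

theorem finite_intersectionLattice (H : Finset (Submodule k (Fin n → k))) :
    (intersectionLattice H).Finite := by
  refine (H.finite_toSet.finite_subsets.image sInf).subset ?_
  rintro X ⟨T, hT, rfl⟩
  exact ⟨T, hT, rfl⟩

/-- Part (2) of Proposition 3.9: `V_{A*} ⊇ ⋂_{X ∈ A} V_{H/X}`. -/
theorem iInter_VHX_subset_union_blocker (H : Finset (Submodule k (Fin n → k)))
    (hH : ∀ h ∈ H, Module.finrank k h = n - 1)
    (A : Set (Submodule k (Fin n → k))) (hA : IsEmbeddedArrangement H A) :
    (⋂ X ∈ A, VHX H X) ⊆ ⋃ Y ∈ arrBlocker H A, (Y : Set (Fin n → k)) := by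
  intro v hv
  simp only [VHX, Set.mem_iInter, Set.mem_iUnion, Set.mem_ofPred_eq, SetLike.mem_coe,
    exists_prop] at hv ⊢
  let T : Set (Submodule k (Fin n → k)) := {h | h ∈ H ∧ v ∈ h}
  have hfin : {Y | Y ∈ intersectionLattice H ∧ ∀ a ∈ A, ∃ h ∈ H, a ≤ h ∧ Y ≤ h}.Finite :=
    (finite_intersectionLattice H).subset fun _ hY => hY.1
  have hT : sInf T ∈ {Y | Y ∈ intersectionLattice H ∧ ∀ a ∈ A, ∃ h ∈ H, a ≤ h ∧ Y ≤ h} := by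
    refine ⟨⟨T, fun h hh => hh.1, rfl⟩, fun a ha => ?_⟩
    obtain ⟨h, ⟨hhH, hah⟩, hvh⟩ := hv a ha
    exact ⟨h, hhH, hah, sInf_le ⟨hhH, hvh⟩⟩
  obtain ⟨Y, hTY, hY⟩ := hfin.exists_le_maximal hT
  exact ⟨Y, hY, hTY (Submodule.mem_sInf.2 fun h hh => hh.2)⟩
end

section
/- Let J and J' be two ideals of k[x_1, …, x_n], each generated by a set of homogeneous degree-1 polynomials. Then the ideal J ∩ J' is generated by products of linear forms; that is, there exists a set G of polynomials, each of which is a product of finitely many homogeneous degree-1 polynomials, such that J ∩ J' is the ideal generated by G. -/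
open MvPolynomial

/-- A subspace `W` is the kernel of a projection `p` which moves the elements of a given
subspace `V` only along `V ⊓ W`. -/
theorem Submodule.exists_projection_sub_mem_inf {K E : Type*} [Field K] [AddCommGroup E]
    [Module K E] (V W : Submodule K E) :
    ∃ p : E →ₗ[K] E, (∀ w ∈ W, p w = 0) ∧ (∀ x, x - p x ∈ W) ∧ ∀ v ∈ V, v - p v ∈ V ⊓ W := by
  obtain ⟨A, hdisj, hsup⟩ := IsModularLattice.exists_disjoint_and_sup_eq (inf_le_left : V ⊓ W ≤ V)
  have hAV : A ≤ V := hsup ▸ le_sup_right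
  have hAW : Disjoint A W := by
    rw [Submodule.disjoint_def] at hdisj ⊢
    exact fun x hA hW ↦ hdisj x ⟨hAV hA, hW⟩ hA
  obtain ⟨B, hAB, hB⟩ := hAW.exists_isCompl
  have hker : ∀ w ∈ W, B.projection W hB w = 0 := fun w hw ↦
    (Submodule.projection_apply_eq_zero_iff hB).2 hw
  refine ⟨B.projection W hB, hker, Submodule.sub_projection_mem hB, fun v hv ↦ ?_⟩
  rw [← hsup] at hv
  obtain ⟨c, hc, a, ha, rfl⟩ := Submodule.mem_sup.1 hv
  rw [map_add, hker c hc.2, Submodule.projection_apply_of_mem_left hB (hAB ha)]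
  simpa using hc

/-- The intersection of the ideals generated by two spaces of linear forms is generated by the
common linear forms and the products of a linear form from each space. -/
theorem MvPolynomial.span_inf_span_eq_of_le_homogeneousSubmodule_one {σ K : Type*} [Field K]
    {V W : Submodule K (MvPolynomial σ K)} (hV : V ≤ homogeneousSubmodule σ K 1)
    (hW : W ≤ homogeneousSubmodule σ K 1) :
    Ideal.span (V : Set (MvPolynomial σ K)) ⊓ Ideal.span (W : Set (MvPolynomial σ K)) =
      Ideal.span ((V ⊓ W : Submodule K (MvPolynomial σ K)) : Set (MvPolynomial σ K)) ⊔
        Ideal.span (V : Set (MvPolynomial σ K)) * Ideal.span (W : Set (MvPolynomial σ K)) := by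
  refine le_antisymm ?_ (sup_le (le_inf (Ideal.span_mono fun x hx ↦ hx.1)
    (Ideal.span_mono fun x hx ↦ hx.2)) Ideal.mul_le_inf)
  obtain ⟨p, hpW, hsub, hpV⟩ := Submodule.exists_projection_sub_mem_inf V W
  let φ : MvPolynomial σ K →ₐ[K] MvPolynomial σ K := aeval fun i ↦ p (X i)
  have hφ : ∀ l ∈ homogeneousSubmodule σ K 1, φ l = p l := by
    rw [homogeneousSubmodule_one_eq_span_X]
    refine LinearMap.eqOn_span' (f := φ.toLinearMap) ?_
    rintro _ ⟨i, rfl⟩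
    simp [φ]
  have hφsub : ∀ f, f - φ f ∈ Ideal.span (W : Set (MvPolynomial σ K)) := fun f ↦ by
    induction f using MvPolynomial.induction_on with
    | C a => simp [φ]
    | add f g hf hg => simpa [add_sub_add_comm] using add_mem hf hg
    | mul_X f i hf =>
      have hX : X i - φ (X i) ∈ Ideal.span (W : Set (MvPolynomial σ K)) :=
        Ideal.subset_span (by simpa [φ] using hsub (X i))
      rw [map_mul, show f * X i - φ f * φ (X i) =
        X i * (f - φ f) + φ f * (X i - φ (X i)) by ring]
      exact add_mem (Ideal.mul_mem_left _ _ hf) (Ideal.mul_mem_left _ _ hX)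
  have hφker : ∀ f ∈ Ideal.span (W : Set (MvPolynomial σ K)), φ f = 0 := fun f hf ↦ by
    have hle : Ideal.span (W : Set (MvPolynomial σ K)) ≤ RingHom.ker φ :=
      Ideal.span_le.2 fun w hw ↦ by
        rw [SetLike.mem_coe, RingHom.mem_ker, hφ w (hW hw), hpW w hw]
    exact hle hf
  rintro f ⟨hfV, hfW⟩
  rw [← sub_zero f, ← hφker f hfW]
  clear hfW
  induction hfV using Submodule.span_induction with
  | zero => simp
  | add f g _ _ hf hg => simpa [add_sub_add_comm] using add_mem hf hg
  | smul h f hf ih =>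
    rw [smul_eq_mul, map_mul, show h * f - φ h * φ f =
      φ h * (f - φ f) + f * (h - φ h) by ring]
    exact add_mem (Ideal.mul_mem_left _ _ ih)
      (Ideal.mem_sup_right (Ideal.mul_mem_mul hf (hφsub h)))
  | mem v hv =>
    rw [hφ v (hV hv)]
    exact Ideal.mem_sup_left (Ideal.subset_span (hpV v hv))

/-- Proposition 4.4: the intersection of two linear ideals is generated by
products of linear forms. -/
theorem inf_linear_ideals_pl_generated {k : Type*} [Field k] {n : ℕ}
    (J J' : Ideal (MvPolynomial (Fin n) k))
    (hJ : ∃ G : Set (MvPolynomial (Fin n) k),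
      (∀ g ∈ G, g.IsHomogeneous 1) ∧ J = Ideal.span G)
    (hJ' : ∃ G : Set (MvPolynomial (Fin n) k),
      (∀ g ∈ G, g.IsHomogeneous 1) ∧ J' = Ideal.span G) :
    ∃ G : Set (MvPolynomial (Fin n) k),
      (∀ g ∈ G, ∃ q : ℕ, 1 ≤ q ∧ ∃ L : Fin q → MvPolynomial (Fin n) k,
        (∀ j, (L j).IsHomogeneous 1) ∧ g = ∏ j, L j) ∧
      J ⊓ J' = Ideal.span G := by
  obtain ⟨G, hG, rfl⟩ := hJ
  obtain ⟨G', hG', rfl⟩ := hJ'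
  have hV : Submodule.span k G ≤ homogeneousSubmodule (Fin n) k 1 := Submodule.span_le.2 hG
  have hW : Submodule.span k G' ≤ homogeneousSubmodule (Fin n) k 1 := Submodule.span_le.2 hG'
  have hspan (S : Set (MvPolynomial (Fin n) k)) :
      Ideal.span S = Ideal.span (Submodule.span k S : Set (MvPolynomial (Fin n) k)) :=
    (Submodule.span_span_of_tower k (MvPolynomial (Fin n) k) S).symm
  refine ⟨((Submodule.span k G ⊓ Submodule.span k G' : Submodule k _) :
    Set (MvPolynomial (Fin n) k)) ∪ {f | ∃ v ∈ Submodule.span k G, ∃ w ∈ Submodule.span k G',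
      v * w = f}, ?_, ?_⟩
  · rintro g (hg | ⟨v, hv, w, hw, rfl⟩)
    · exact ⟨1, le_rfl, fun _ ↦ g, fun _ ↦ hV hg.1, by simp⟩
    · refine ⟨2, one_le_two, ![v, w], fun j ↦ ?_, by simp⟩
      fin_cases j
      · exact hV hv
      · exact hW hw
  · rw [hspan G, hspan G', span_inf_span_eq_of_le_homogeneousSubmodule_one hV hW,
      Ideal.span_union, Ideal.span_mul_span]
    rfl
end
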